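/- Let d : ℕ → ℕ satisfy d i ≥ 2 for all i, let V be the vertex set of the spherically homogeneous rooted tree with branching sequence d, and let G be a group acting faithfully on V by rooted-tree automorphisms. Suppose that the union over all vertices v of the subtree stabilizers Fix_G(vT) = {g ∈ G | ∀ w, v ≼ w → g • w = w} is a finite subset of G of cardinality n. Then for every finite subset F ⊆ G with 1 ∉ F there exists an n-tuple z : Fin n → V such that for every g ∈ F there is an index i with g • (z i) ≠ z i. -/

import Mathlib

/-- Vertex set of the spherically homogeneous rooted tree with branching sequence `d`:
a vertex of level `n` is a word `x : Π i : Fin n, Fin (d i)`. -/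
def TreeVertex (d : ℕ → ℕ) : Type := Σ n : ℕ, (∀ i : Fin n, Fin (d i))

/-- `IsAncestor v w` : the vertex `v` is an ancestor of `w` (i.e. `w` belongs to the
subtree rooted at `v`). -/
def IsAncestor {d : ℕ → ℕ} (v w : TreeVertex d) : Prop :=
  ∃ h : v.1 ≤ w.1, ∀ i : Fin v.1, v.2 i = w.2 (Fin.castLE h i)

theorem IsAncestor.refl {d : ℕ → ℕ} (v : TreeVertex d) : IsAncestor v v :=
  ⟨le_rfl, fun _ => rfl⟩

theorem IsAncestor.trans {d : ℕ → ℕ} {u v w : TreeVertex d} (huv : IsAncestor u v)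
    (hvw : IsAncestor v w) : IsAncestor u w := by
  obtain ⟨h₁, e₁⟩ := huv
  obtain ⟨h₂, e₂⟩ := hvw
  exact ⟨h₁.trans h₂, fun i => (e₁ i).trans (e₂ (Fin.castLE h₁ i))⟩

/-- Two ancestors of the same vertex lying on the same level coincide. -/
theorem IsAncestor.eq_of_level_eq {d : ℕ → ℕ} {u v w : TreeVertex d} (huw : IsAncestor u w)
    (hvw : IsAncestor v w) (h : u.1 = v.1) : u = v := by
  obtain ⟨m, x⟩ := u
  obtain ⟨m', y⟩ := v
  obtain rfl : m = m' := h
  obtain ⟨_, e₁⟩ := huw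
  obtain ⟨_, e₂⟩ := hvw
  have hxy : x = y := funext fun i => (e₁ i).trans (e₂ i).symm
  rw [hxy]

/-- A tree automorphism fixing a vertex fixes all its ancestors. -/
theorem IsAncestor.smul_eq_of_smul_eq {d : ℕ → ℕ} {G : Type*} [Group G]
    [MulAction G (TreeVertex d)]
    (hlevel : ∀ (g : G) (v : TreeVertex d), (g • v).1 = v.1)
    (hanc : ∀ (g : G) (v w : TreeVertex d), IsAncestor v w → IsAncestor (g • v) (g • w))
    {g : G} {v w : TreeVertex d} (hvw : IsAncestor v w) (hw : g • w = w) : g • v = v := by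
  have h := hanc g v w hvw
  rw [hw] at h
  exact h.eq_of_level_eq hvw (hlevel g v)

/-- If no element of a finite set fixes a whole subtree, then some vertex is moved by all of
them. -/
theorem exists_vertex_forall_smul_ne {d : ℕ → ℕ} {G : Type*} [Group G]
    [MulAction G (TreeVertex d)]
    (hlevel : ∀ (g : G) (v : TreeVertex d), (g • v).1 = v.1)
    (hanc : ∀ (g : G) (v w : TreeVertex d), IsAncestor v w → IsAncestor (g • v) (g • w))
    (F : Finset G) (hF : ∀ g ∈ F, ∀ v : TreeVertex d, ∃ w, IsAncestor v w ∧ g • w ≠ w) :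
    ∃ z : TreeVertex d, ∀ g ∈ F, g • z ≠ z := by
  classical
  induction F using Finset.induction_on with
  | empty => exact ⟨⟨0, fun i => i.elim0⟩, by simp⟩
  | insert a F _ ih =>
    obtain ⟨z, hz⟩ := ih fun g hg => hF g (Finset.mem_insert_of_mem hg)
    obtain ⟨w, hzw, hw⟩ := hF a (Finset.mem_insert_self a F) z
    refine ⟨w, fun g hg => ?_⟩
    rcases Finset.mem_insert.mp hg with rfl | hg
    · exact hw
    · exact fun h => hz g hg (hzw.smul_eq_of_smul_eq hlevel hanc h)

/-- If `G` acts faithfully by rooted-tree automorphisms and the union of all subtree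
stabilizers is finite of cardinality `n`, then the diagonal action on `n`-tuples of
vertices is locally somewhere free. -/
theorem finite_union_subtree_stabilizers_imp_lsf_power
    (d : ℕ → ℕ) (hd : ∀ i, 2 ≤ d i)
    (G : Type*) [Group G] [MulAction G (TreeVertex d)]
    (hlevel : ∀ (g : G) (v : TreeVertex d), (g • v).1 = v.1)
    (hanc : ∀ (g : G) (v w : TreeVertex d), IsAncestor v w → IsAncestor (g • v) (g • w))
    (hfaith : ∀ g : G, (∀ v : TreeVertex d, g • v = v) → g = 1)
    (n : ℕ) (S : Set G)
    (hSdef : S = ⋃ v : TreeVertex d, {g : G | ∀ w, IsAncestor v w → g • w = w})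
    (hSfin : S.Finite) (hScard : S.ncard = n)
    (F : Finset G) (hF : (1 : G) ∉ F) :
    ∃ z : Fin n → TreeVertex d, ∀ g ∈ F, ∃ i : Fin n, g • z i ≠ z i := by
  classical
  have mem_S (g : G) : g ∈ S ↔ ∃ v : TreeVertex d, ∀ w, IsAncestor v w → g • w = w := by
    simp [hSdef]
  obtain ⟨z₀, hz₀⟩ := exists_vertex_forall_smul_ne hlevel hanc (F.filter (· ∉ S)) (by
    intro g hg v
    by_contra! h
    exact (Finset.mem_filter.mp hg).2 ((mem_S g).mpr ⟨v, h⟩))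
  have hmoved (g : G) : ∃ v : TreeVertex d, g ≠ 1 → g • v ≠ v := by
    by_contra! h
    exact (h ⟨0, fun i => i.elim0⟩).1 (hfaith g fun v => (h v).2)
  choose m hm using hmoved
  have := hSfin.to_subtype
  let e : S ≃ Fin n := Finite.equivFinOfCardEq hScard
  refine ⟨fun i => if (e.symm i : G) = 1 then z₀ else m (e.symm i), fun g hg => ?_⟩
  have hg1 : g ≠ 1 := fun h => hF (h ▸ hg)
  by_cases hgS : g ∈ S
  · exact ⟨e ⟨g, hgS⟩, by simpa [hg1] using hm g hg1⟩
  · have h1 : (1 : G) ∈ S := (mem_S 1).mpr ⟨z₀, fun w _ => one_smul G w⟩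
    exact ⟨e ⟨1, h1⟩, by simpa using hz₀ g (Finset.mem_filter.mpr ⟨hg, hgS⟩)⟩
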